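/- arXiv:0709.1477 — 3 statements merged into one kernel-verified Lean document; each statement's English description precedes it below -/
import Mathlib

section
/- Let n ≥ 1 and let T be a subset of {1,…,n−1} with T ≠ ∅ and T ≠ {1,…,n−1}. Then the set of all permutations σ ∈ S_n whose descent set equals T, namely {σ ∈ S_n : Des(σ) = T}, generates the full symmetric group S_n. -/
/-- The descent set of a permutation of `Fin (n+1)`, as a finset of `Fin n`. -/
def Des {n : ℕ} (σ : Equiv.Perm (Fin (n + 1))) : Finset (Fin n) :=
  Finset.univ.filter (fun i : Fin n => σ i.succ < σ i.castSucc)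

def AdjZ (x y : ℤ) : Prop := x = y + 1 ∨ y = x + 1

/-- abstract families of position functions -/
structure Fam (N : ℕ) (F : Set (ℕ → ℤ)) : Prop where
  inj : ∀ p ∈ F, ∀ a b, a < N → b < N → a ≠ b → p a ≠ p b
  sw : ∀ p ∈ F, ∀ k, k + 1 < N → ¬ AdjZ (p k) (p (k+1)) →
    ∃ q ∈ F, q k = p (k+1) ∧ q (k+1) = p k ∧ ∀ j, j < N → j ≠ k → j ≠ k + 1 → q j = p j

def BadK (F : Set (ℕ → ℤ)) (k : ℕ) : Prop := ∀ p ∈ F, AdjZ (p k) (p (k+1))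

theorem Fam.up {N : ℕ} {F : Set (ℕ → ℤ)} (h : Fam N F) {k : ℕ} (hk : k + 2 < N) (hb : BadK F k) :
    ∀ p ∈ F, AdjZ (p (k+2)) (p (k+1)) ∨ AdjZ (p (k+2)) (p k) := by
  intro p hp
  by_cases hc : AdjZ (p (k+1)) (p (k+1+1))
  · left; exact Or.symm hc
  · obtain ⟨q, hq, h1, h2, h3⟩ := h.sw p hp (k+1) (by omega) hc
    have := hb q hq
    rw [h1, h3 k (by omega) (by omega) (by omega)] at this
    right; exact Or.symm this

theorem Fam.down {N : ℕ} {F : Set (ℕ → ℤ)} (h : Fam N F) {k : ℕ} (hk : k + 2 < N)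
    (hb : BadK F (k+1)) :
    ∀ p ∈ F, AdjZ (p k) (p (k+1)) ∨ AdjZ (p k) (p (k+2)) := by
  intro p hp
  by_cases hc : AdjZ (p k) (p (k+1))
  · left; exact hc
  · obtain ⟨q, hq, h1, h2, h3⟩ := h.sw p hp k (by omega) hc
    have := hb q hq
    rw [h2, h3 (k+1+1) (by omega) (by omega) (by omega)] at this
    right; exact this

theorem Fam.both {N : ℕ} {F : Set (ℕ → ℤ)} (h : Fam N F) {k : ℕ} (hk : k + 3 < N)
    (hb : BadK F (k+1)) : BadK F k ∧ BadK F (k+2) := by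
  have hu := h.up (k := k+1) (by omega) hb
  have hd := h.down (k := k) (by omega) hb
  constructor
  · intro p hp
    by_contra hc
    have hu1 := hu p hp
    have hd1 := hd p hp
    have hb1 := hb p hp
    obtain ⟨q, hq, h1, h2, h3⟩ := h.sw p hp k (by omega) hc
    have hu2 := hu q hq
    have e1 := h3 (k+1+1) (by omega) (by omega) (by omega)
    have e2 := h3 (k+1+2) (by omega) (by omega) (by omega)
    rw [e1, e2, h2] at hu2
    have i1 := h.inj p hp k (k+1) (by omega) (by omega) (by omega)
    have i2 := h.inj p hp k (k+2) (by omega) (by omega) (by omega)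
    have i3 := h.inj p hp k (k+3) (by omega) (by omega) (by omega)
    have i4 := h.inj p hp (k+1) (k+2) (by omega) (by omega) (by omega)
    have i5 := h.inj p hp (k+1) (k+3) (by omega) (by omega) (by omega)
    have i6 := h.inj p hp (k+2) (k+3) (by omega) (by omega) (by omega)
    simp only [AdjZ, add_assoc, Nat.reduceAdd] at *
    omega
  · intro p hp
    by_contra hc
    have hu1 := hu p hp
    have hd1 := hd p hp
    have hb1 := hb p hp
    obtain ⟨q, hq, h1, h2, h3⟩ := h.sw p hp (k+2) (by omega) hc
    have hd2 := hd q hq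
    have e1 := h3 k (by omega) (by omega) (by omega)
    have e2 := h3 (k+1) (by omega) (by omega) (by omega)
    rw [e1, e2, h1] at hd2
    have i1 := h.inj p hp k (k+1) (by omega) (by omega) (by omega)
    have i2 := h.inj p hp k (k+2) (by omega) (by omega) (by omega)
    have i3 := h.inj p hp k (k+3) (by omega) (by omega) (by omega)
    have i4 := h.inj p hp (k+1) (k+2) (by omega) (by omega) (by omega)
    have i5 := h.inj p hp (k+1) (k+3) (by omega) (by omega) (by omega)
    have i6 := h.inj p hp (k+2) (k+3) (by omega) (by omega) (by omega)
    simp only [AdjZ, add_assoc, Nat.reduceAdd] at *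
    omega

theorem Fam.all {N : ℕ} {F : Set (ℕ → ℤ)} (h : Fam N F) {k : ℕ} (hk : k + 3 < N)
    (hb : BadK F (k+1)) : ∀ m, m + 1 < N → BadK F m := by
  have up : ∀ j, k + 1 + j + 1 < N → BadK F (k+1+j) := by
    intro j
    induction j with
    | zero => intro _; exact hb
    | succ j ih =>
      intro hj
      have := (h.both (k := k + j) (by omega) (by have := ih (by omega); rwa [show k + j + 1 = k + 1 + j by omega])).2
      rwa [show k + 1 + (j+1) = k + j + 2 by omega]
  have down : ∀ j, j ≤ k + 1 → BadK F (k+1-j) := by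
    intro j
    induction j with
    | zero => intro _; exact hb
    | succ j ih =>
      intro hj
      have := (h.both (k := k - j) (by omega) (by have := ih (by omega); rwa [show k - j + 1 = k + 1 - j by omega])).1
      rwa [show k + 1 - (j+1) = k - j by omega]
  intro m hm
  by_cases h1 : m ≤ k + 1
  · have := down (k+1-m) (by omega)
    rwa [show k + 1 - (k + 1 - m) = m by omega] at this
  · have := up (m - (k+1)) (by omega)
    rwa [show k + 1 + (m - (k + 1)) = m by omega] at this

theorem Fam.linear {N : ℕ} {F : Set (ℕ → ℤ)} (h : Fam N F) (hN : 2 ≤ N)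
    (hb : ∀ m, m + 1 < N → BadK F m) (p : ℕ → ℤ) (hp : p ∈ F) :
    (∀ m, m < N → p m = p 0 + m) ∨ (∀ m, m < N → p m = p 0 - m) := by
  have key : ∀ m, m + 1 < N → p (m+1) - p m = p 1 - p 0 := by
    intro m
    induction m with
    | zero => intro _; simp
    | succ m ih =>
      intro hm
      have h1 := ih (by omega)
      have h2 := hb m (by omega) p hp
      have h3 := hb (m+1) (by omega) p hp
      have i1 := h.inj p hp m (m+1+1) (by omega) (by omega) (by omega)
      unfold AdjZ at *
      omega
  have h0 := hb 0 (by omega) p hp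
  rcases h0 with h0 | h0
  · right
    intro m
    induction m with
    | zero => intro _; simp
    | succ m ih =>
      intro hm
      have := ih (by omega)
      have := key m hm
      push_cast
      simp only [zero_add] at h0
      omega
  · left
    intro m
    induction m with
    | zero => intro _; simp
    | succ m ih =>
      intro hm
      have := ih (by omega)
      have := key m hm
      push_cast
      simp only [zero_add] at h0
      omega

theorem des_nonempty {n : ℕ} (T : Finset (Fin n)) :
    ∃ σ : Equiv.Perm (Fin (n + 1)), Des σ = T := by
  let g : ℕ → ℤ := fun j => if h : j < n then (if (⟨j, h⟩ : Fin n) ∈ T then -1 else 1) else 0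
  let f : Fin (n+1) → ℤ := fun i => ∑ j ∈ Finset.range i, g j
  have hm : Monotone (f ∘ Tuple.sort f) := Tuple.monotone_sort f
  have hlt : ∀ a b, f a < f b → (Tuple.sort f)⁻¹ a < (Tuple.sort f)⁻¹ b := by
    intro a b hab
    by_contra hc
    have := hm (not_lt.mp hc)
    simp at this
    omega
  have hf : ∀ i : Fin n, f i.succ = f i.castSucc + if i ∈ T then -1 else 1 := by
    intro i
    simp only [f, Fin.val_succ, Finset.sum_range_succ, Fin.val_castSucc]
    congr 1
    simp [g]
  refine ⟨(Tuple.sort f)⁻¹, ?_⟩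
  ext i
  simp only [Des, Finset.mem_filter, Finset.mem_univ, true_and]
  have h1 := hf i
  constructor
  · intro h
    by_contra hT
    rw [if_neg hT] at h1
    have := hlt i.castSucc i.succ (by omega)
    exact absurd h (not_lt.mpr this.le)
  · intro hT
    rw [if_pos hT] at h1
    exact hlt i.succ i.castSucc (by omega)

theorem swap_lt {n : ℕ} (k : Fin n) (a b : Fin (n+1))
    (h1 : ¬ (a = k.castSucc ∧ b = k.succ)) (h2 : ¬ (b = k.castSucc ∧ a = k.succ)) :
    Equiv.swap k.castSucc k.succ a < Equiv.swap k.castSucc k.succ b ↔ a < b := by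
  simp only [Equiv.swap_apply_def]
  split_ifs <;> simp only [Fin.ext_iff, Fin.lt_def, Fin.val_castSucc, Fin.val_succ] at * <;> omega

theorem des_swap {n : ℕ} (σ : Equiv.Perm (Fin (n + 1))) (k : Fin n)
    (h : ¬ AdjZ ((σ⁻¹ k.castSucc : Fin (n+1)) : ℕ) ((σ⁻¹ k.succ : Fin (n+1)) : ℕ)) :
    Des (Equiv.swap k.castSucc k.succ * σ) = Des σ := by
  ext i
  simp only [Des, Finset.mem_filter, Finset.mem_univ, true_and]
  simp only [Equiv.Perm.mul_apply]
  apply swap_lt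
  · rintro ⟨h1, h2⟩
    apply h
    rw [← h1, ← h2]
    simp [AdjZ]
  · rintro ⟨h1, h2⟩
    apply h
    rw [← h1, ← h2]
    simp [AdjZ]

def posF {n : ℕ} (σ : Equiv.Perm (Fin (n + 1))) (m : ℕ) : ℤ :=
  ((σ⁻¹ (Fin.ofNat (n+1) m) : Fin (n+1)) : ℕ)

theorem posF_eq {n : ℕ} (σ : Equiv.Perm (Fin (n + 1))) (i : Fin (n+1)) :
    posF σ i = ((σ⁻¹ i : Fin (n+1)) : ℕ) := by
  simp [posF]

theorem posF_apply {n : ℕ} (σ : Equiv.Perm (Fin (n + 1))) (i : Fin (n+1)) :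
    posF σ (σ i) = (i : ℕ) := by
  rw [posF_eq]; simp

theorem fam_class {n : ℕ} (T : Finset (Fin n)) :
    Fam (n+1) (posF '' {σ : Equiv.Perm (Fin (n + 1)) | Des σ = T}) := by
  constructor
  · rintro _ ⟨σ, hσ, rfl⟩ a b ha hb hab h
    rw [posF_eq σ ⟨a, ha⟩, posF_eq σ ⟨b, hb⟩] at h
    have : σ⁻¹ (⟨a, ha⟩ : Fin (n+1)) = σ⁻¹ ⟨b, hb⟩ := Fin.ext (by exact_mod_cast h)
    have := σ⁻¹.injective this
    simp at this
    exact hab this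
  · rintro _ ⟨σ, hσ, rfl⟩ k hk h
    have hk' : k < n := by omega
    have e1 := posF_eq σ (Fin.castSucc ⟨k, hk'⟩)
    have e2 := posF_eq σ (Fin.succ ⟨k, hk'⟩)
    have h' : ¬ AdjZ ((σ⁻¹ (Fin.castSucc ⟨k, hk'⟩) : Fin (n+1)) : ℕ)
      ((σ⁻¹ (Fin.succ ⟨k, hk'⟩) : Fin (n+1)) : ℕ) := by
      rw [← e1, ← e2]; exact h
    refine ⟨_, ⟨_, (des_swap σ _ h').trans hσ, rfl⟩, ?_, ?_, ?_⟩
    · have := posF_eq (Equiv.swap (Fin.castSucc ⟨k, hk'⟩) (Fin.succ ⟨k, hk'⟩) * σ) (Fin.castSucc ⟨k, hk'⟩)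
      refine this.trans ?_
      rw [mul_inv_rev, Equiv.swap_inv, Equiv.Perm.mul_apply, Equiv.swap_apply_left, ← e2]
      rfl
    · have := posF_eq (Equiv.swap (Fin.castSucc ⟨k, hk'⟩) (Fin.succ ⟨k, hk'⟩) * σ) (Fin.succ ⟨k, hk'⟩)
      refine this.trans ?_
      rw [mul_inv_rev, Equiv.swap_inv, Equiv.Perm.mul_apply, Equiv.swap_apply_right, ← e1]
      rfl
    · intro j hj h1 h2
      rw [posF_eq _ ⟨j, hj⟩, posF_eq _ ⟨j, hj⟩]
      rw [mul_inv_rev, Equiv.swap_inv, Equiv.Perm.mul_apply, Equiv.swap_apply_of_ne_of_ne]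
      · simpa [Fin.ext_iff] using h1
      · simpa [Fin.ext_iff] using h2

theorem good_mem {n : ℕ} (T : Finset (Fin n)) (k : ℕ) (hk : k < n)
    (h : ¬ BadK (posF '' {σ : Equiv.Perm (Fin (n + 1)) | Des σ = T}) k) :
    Equiv.swap (Fin.castSucc ⟨k, hk⟩) (Fin.succ ⟨k, hk⟩) ∈
      Subgroup.closure {σ : Equiv.Perm (Fin (n + 1)) | Des σ = T} := by
  simp only [BadK, not_forall] at h
  obtain ⟨_, ⟨σ, hσ, rfl⟩, h⟩ := h
  have e1 := posF_eq σ (Fin.castSucc ⟨k, hk⟩)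
  have e2 := posF_eq σ (Fin.succ ⟨k, hk⟩)
  have h' : ¬ AdjZ ((σ⁻¹ (Fin.castSucc ⟨k, hk⟩) : Fin (n+1)) : ℕ)
      ((σ⁻¹ (Fin.succ ⟨k, hk⟩) : Fin (n+1)) : ℕ) := by
    rw [← e1, ← e2]; exact h
  have h1 := Subgroup.subset_closure (k := {σ : Equiv.Perm (Fin (n + 1)) | Des σ = T})
    ((des_swap σ _ h').trans hσ)
  have h2 := Subgroup.subset_closure (k := {σ : Equiv.Perm (Fin (n + 1)) | Des σ = T}) hσ
  exact (Subgroup.mul_mem_cancel_right _ h2).mp h1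

theorem conn {n : ℕ} (H : Subgroup (Equiv.Perm (Fin (n+1)))) (lo hi : ℕ) (hhi : hi ≤ n)
    (h : ∀ k (hk : k < n), lo ≤ k → k < hi →
      Equiv.swap (Fin.castSucc ⟨k, hk⟩) (Fin.succ ⟨k, hk⟩) ∈ H) :
    ∀ a b : Fin (n+1), lo ≤ a → (a : ℕ) ≤ hi → lo ≤ b → (b : ℕ) ≤ hi → Equiv.swap a b ∈ H := by
  have key : ∀ d (a b : Fin (n+1)), lo ≤ a → (b : ℕ) ≤ hi → (b : ℕ) = a + d → Equiv.swap a b ∈ H := by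
    intro d
    induction d with
    | zero =>
      intro a b _ _ hab
      have : a = b := Fin.ext (by omega)
      subst this
      rw [Equiv.swap_self]
      exact H.one_mem
    | succ d ih =>
      intro a b ha hb hab
      have hc : (a : ℕ) + d < n := by omega
      have h1 := ih a (Fin.castSucc ⟨a + d, hc⟩) ha (by simp; omega) (by simp)
      have h2 := h (a + d) hc (by omega) (by omega)
      have : Fin.succ ⟨a + d, hc⟩ = b := Fin.ext (by simp; omega)
      rw [this] at h2
      exact SubmonoidClass.swap_mem_trans _ h1 h2
  intro a b ha ha' hb hb'
  rcases le_total (a : ℕ) b with hab | hab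
  · exact key (b - a) a b ha hb' (by omega)
  · rw [Equiv.swap_comm]
    exact key (a - b) b a hb ha' (by omega)

theorem ext_conn {n : ℕ} (H : Subgroup (Equiv.Perm (Fin (n+1)))) (lo hi : ℕ)
    (h : ∀ a b : Fin (n+1), lo ≤ a → (a : ℕ) ≤ hi → lo ≤ b → (b : ℕ) ≤ hi → Equiv.swap a b ∈ H)
    (σ : Equiv.Perm (Fin (n+1))) (hσ : σ ∈ H) (v i j : Fin (n+1)) (hv : σ i = v)
    (hi1 : lo ≤ i) (hi2 : (i : ℕ) ≤ hi) (hj1 : lo ≤ j) (hj2 : (j : ℕ) ≤ hi)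
    (hs1 : lo ≤ σ j) (hs2 : (σ j : ℕ) ≤ hi) (w : Fin (n+1)) (hw1 : lo ≤ w) (hw2 : (w : ℕ) ≤ hi) :
    Equiv.swap v w ∈ H := by
  have h1 := h i j hi1 hi2 hj1 hj2
  have h2 := H.mul_mem (H.mul_mem hσ h1) (H.inv_mem hσ)
  have h3 : σ * Equiv.swap i j * σ⁻¹ = Equiv.swap (σ i) (σ j) := by
    rw [Equiv.mul_swap_eq_swap_mul]; simp
  rw [h3, hv] at h2
  exact SubmonoidClass.swap_mem_trans _ h2 (h _ _ hs1 hs2 hw1 hw2)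

/-- every descent class other than the one of the identity
(empty descent set) and the one of the longest element (full descent set)
generates the full symmetric group. -/
theorem descent_class_generates (n : ℕ) (T : Finset (Fin n))
    (hT1 : T ≠ ∅) (hT2 : T ≠ Finset.univ) :
    Subgroup.closure {σ : Equiv.Perm (Fin (n + 1)) | Des σ = T} = ⊤ := by
  set H := Subgroup.closure {σ : Equiv.Perm (Fin (n + 1)) | Des σ = T} with hH
  set F := posF '' {σ : Equiv.Perm (Fin (n + 1)) | Des σ = T} with hF
  have fam : Fam (n+1) F := fam_class T
  obtain ⟨i, hi⟩ := Finset.nonempty_iff_ne_empty.mpr hT1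
  obtain ⟨j, hj⟩ : ∃ j, j ∉ T := by
    by_contra hc
    push Not at hc
    exact hT2 (Finset.eq_univ_iff_forall.mpr hc)
  have hn : 2 ≤ n := by
    by_contra hc
    have : i = j := Fin.ext (by omega)
    exact hj (this ▸ hi)
  have notall : ¬ ∀ m, m + 1 < n + 1 → BadK F m := by
    intro hall
    obtain ⟨σ, hσ⟩ := des_nonempty T
    have hl := fam.linear (by omega) hall (posF σ) ⟨σ, hσ, rfl⟩
    rw [← hσ] at hi hj
    simp only [Des, Finset.mem_filter, Finset.mem_univ, true_and, not_lt, Fin.lt_def,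
      Fin.le_def] at hi hj
    have a1 := posF_apply σ i.succ
    have a2 := posF_apply σ i.castSucc
    have a3 := posF_apply σ j.succ
    have a4 := posF_apply σ j.castSucc
    simp only [Fin.val_succ, Fin.val_castSucc] at a1 a2 a3 a4
    rcases hl with hl | hl
    all_goals
      have b1 := hl _ (σ i.succ).isLt
      have b2 := hl _ (σ i.castSucc).isLt
      have b3 := hl _ (σ j.succ).isLt
      have b4 := hl _ (σ j.castSucc).isLt
      omega
  have mid : ∀ k, 1 ≤ k → k + 2 ≤ n → ¬ BadK F k := by
    intro k h1 h2 hb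
    obtain ⟨k, rfl⟩ : ∃ k', k = k' + 1 := ⟨k - 1, by omega⟩
    exact notall (fam.all (by omega) hb)
  -- interior of position of 0 / n
  have low : BadK F 0 → ¬ BadK F 1 → ∃ σ ∈ H, ∃ i : Fin (n+1), σ i = 0 ∧ 1 ≤ (i : ℕ) ∧ (i : ℕ) < n := by
    intro h0 h1
    simp only [BadK, not_forall] at h1
    obtain ⟨_, ⟨σ, hσ, rfl⟩, h1⟩ := h1
    have u := fam.up (k := 0) (by omega) h0 _ ⟨σ, hσ, rfl⟩
    have v := h0 _ ⟨σ, hσ, rfl⟩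
    have ij := fam.inj _ ⟨σ, hσ, rfl⟩ 1 2 (by omega) (by omega) (by omega)
    have e0 := posF_eq σ ⟨0, by omega⟩
    have e1 := posF_eq σ ⟨1, by omega⟩
    have e2 := posF_eq σ ⟨2, by omega⟩
    have l1 := (σ⁻¹ ⟨1, by omega⟩ : Fin (n+1)).isLt
    have l2 := (σ⁻¹ ⟨2, by omega⟩ : Fin (n+1)).isLt
    refine ⟨σ, Subgroup.subset_closure hσ, σ⁻¹ ⟨0, by omega⟩, by simp, ?_⟩
    simp only [AdjZ, zero_add, Nat.reduceAdd] at *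
    omega
  have high : BadK F (n-1) → ¬ BadK F (n-2) → ∃ σ ∈ H, ∃ i : Fin (n+1), σ i = Fin.last n ∧ 1 ≤ (i : ℕ) ∧ (i : ℕ) < n := by
    intro h0 h1
    simp only [BadK, not_forall] at h1
    obtain ⟨_, ⟨σ, hσ, rfl⟩, h1⟩ := h1
    have u := fam.down (k := n-2) (by omega) (by rwa [show n - 2 + 1 = n - 1 by omega]) _ ⟨σ, hσ, rfl⟩
    have v := h0 _ ⟨σ, hσ, rfl⟩
    have ij := fam.inj _ ⟨σ, hσ, rfl⟩ (n-2) (n-1) (by omega) (by omega) (by omega)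
    have e0 := posF_eq σ ⟨n, by omega⟩
    have e1 := posF_eq σ ⟨n-1, by omega⟩
    have e2 := posF_eq σ ⟨n-2, by omega⟩
    have l1 := (σ⁻¹ ⟨n-1, by omega⟩ : Fin (n+1)).isLt
    have l2 := (σ⁻¹ ⟨n-2, by omega⟩ : Fin (n+1)).isLt
    refine ⟨σ, Subgroup.subset_closure hσ, σ⁻¹ ⟨n, by omega⟩, by simp [Fin.last], ?_⟩
    simp only [AdjZ, show n - 2 + 1 = n - 1 by omega, show n - 2 + 2 = n by omega,
      show n - 1 + 1 = n by omega] at *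
    omega
  have inj : ∀ (σ : Equiv.Perm (Fin (n+1))) (a b : Fin (n+1)), (a : ℕ) ≠ b → (σ a : ℕ) ≠ σ b := by
    intro σ a b hab h
    exact hab (congrArg _ (σ.injective (Fin.ext h)))
  have gen : (∀ k (hk : k < n), Equiv.swap (Fin.castSucc ⟨k, hk⟩) (Fin.succ ⟨k, hk⟩) ∈ H) → H = ⊤ := by
    intro hg
    have hc := conn H 0 n le_rfl (fun k hk _ _ => hg k hk)
    rw [eq_top_iff, ← Equiv.Perm.closure_isSwap, Subgroup.closure_le]
    rintro _ ⟨a, b, _, rfl⟩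
    exact hc a b (by omega) (by omega) (by omega) (by omega)
  apply gen
  by_cases b0 : BadK F 0
  · by_cases b1 : BadK F (n-1)
    · have hn3 : 3 ≤ n := by
        by_contra hc
        apply notall
        intro m hm
        obtain rfl | rfl : m = 0 ∨ m = n - 1 := by omega
        · exact b0
        · exact b1
      have g1 := mid 1 (by omega) (by omega)
      have hn4 : 4 ≤ n := by
        by_contra hc
        obtain rfl : n = 3 := by omega
        apply g1
        intro p hp
        have u := fam.up (k := 0) (by omega) b0 p hp
        have v := b0 p hp
        have u' := fam.down (k := 1) (by omega) b1 p hp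
        have v' := b1 p hp
        have ij := fam.inj p hp 1 2 (by omega) (by omega) (by omega)
        have ij' := fam.inj p hp 0 3 (by omega) (by omega) (by omega)
        simp only [AdjZ, zero_add, Nat.reduceAdd, Nat.reduceSub] at *
        omega
      have hc := conn H 1 (n-1) (by omega)
        (fun k hk h1 h2 => good_mem T k hk (mid k h1 (by omega)))
      have pick : ∀ (σ : Equiv.Perm (Fin (n+1))) (i : Fin (n+1)), ((σ i : ℕ) = 0 ∨ (σ i : ℕ) = n) →
          1 ≤ (i : ℕ) → (i : ℕ) < n → ∃ j : Fin (n+1), 1 ≤ (j : ℕ) ∧ (j : ℕ) ≤ n - 1 ∧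
            1 ≤ (σ j : ℕ) ∧ (σ j : ℕ) ≤ n - 1 := by
        intro σ i hi h1 h2
        by_contra hcon
        push Not at hcon
        have c1 := hcon ⟨1, by omega⟩
        have c2 := hcon ⟨2, by omega⟩
        have c3 := hcon ⟨3, by omega⟩
        have d1 := inj σ ⟨1, by omega⟩ ⟨2, by omega⟩ (by simp)
        have d2 := inj σ ⟨1, by omega⟩ ⟨3, by omega⟩ (by simp)
        have d3 := inj σ ⟨2, by omega⟩ ⟨3, by omega⟩ (by simp)
        simp only at c1 c2 c3
        omega
      obtain ⟨σ, hσ, i, hi, hi1, hi2⟩ := low b0 g1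
      obtain ⟨τ, hτ, i', hi', hi1', hi2'⟩ := high b1 (mid (n-2) (by omega) (by omega))
      obtain ⟨j, j1, j2, j3, j4⟩ := pick σ i (by simp [hi]) hi1 hi2
      obtain ⟨j', j1', j2', j3', j4'⟩ := pick τ i' (by simp [hi']) hi1' hi2'
      have r0 := ext_conn H 1 (n-1) hc σ hσ 0 i j hi hi1 (by omega) j1 j2 j3 j4
      have r1 := ext_conn H 1 (n-1) hc τ hτ (Fin.last n) i' j' hi' hi1' (by omega) j1' j2' j3' j4'
      intro k hk
      by_cases k0 : k = 0
      · subst k0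
        exact r0 _ (by simp) (by simp; omega)
      by_cases k1 : k = n - 1
      · have : Fin.succ ⟨k, hk⟩ = Fin.last n := Fin.ext (by simp; omega)
        rw [this, Equiv.swap_comm]
        exact r1 _ (by simp; omega) (by simp; omega)
      · exact good_mem T k hk (mid k (by omega) (by omega))
    · have good : ∀ k, 1 ≤ k → k < n → ¬ BadK F k := by
        intro k h1 h2
        by_cases hk : k = n - 1
        · rwa [hk]
        · exact mid k h1 (by omega)
      have hc := conn H 1 n le_rfl (fun k hk h1 _ => good_mem T k hk (good k h1 hk))
      obtain ⟨σ, hσ, i, hi, hi1, hi2⟩ := low b0 (good 1 le_rfl (by omega))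
      obtain ⟨j, j1, j3⟩ : ∃ j : Fin (n+1), 1 ≤ (j : ℕ) ∧ 1 ≤ (σ j : ℕ) := by
        by_contra hcon
        push Not at hcon
        have c1 := hcon ⟨1, by omega⟩
        have c2 := hcon ⟨2, by omega⟩
        have d1 := inj σ ⟨1, by omega⟩ ⟨2, by omega⟩ (by simp)
        simp only at c1 c2
        omega
      have r0 := ext_conn H 1 n hc σ hσ 0 i j hi hi1 (by omega) j1 (by omega) j3 (by omega)
      intro k hk
      by_cases k0 : k = 0
      · subst k0
        exact r0 _ (by simp) (by simp; omega)
      · exact good_mem T k hk (good k (by omega) hk)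
  · by_cases b1 : BadK F (n-1)
    · have good : ∀ k, k < n - 1 → ¬ BadK F k := by
        intro k h2
        by_cases hk : k = 0
        · rwa [hk]
        · exact mid k (by omega) (by omega)
      have hc := conn H 0 (n-1) (by omega) (fun k hk _ h2 => good_mem T k hk (good k h2))
      obtain ⟨σ, hσ, i, hi, hi1, hi2⟩ := high b1 (good (n-2) (by omega))
      obtain ⟨j, j1, j3⟩ : ∃ j : Fin (n+1), (j : ℕ) ≤ n - 1 ∧ (σ j : ℕ) ≤ n - 1 := by
        by_contra hcon
        push Not at hcon
        have c1 := hcon ⟨0, by omega⟩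
        have c2 := hcon ⟨1, by omega⟩
        have d1 := inj σ ⟨0, by omega⟩ ⟨1, by omega⟩ (by simp)
        simp only at c1 c2
        omega
      have r0 := ext_conn H 0 (n-1) hc σ hσ (Fin.last n) i j hi (by omega) (by omega) (by omega) j1 (by omega) j3
      intro k hk
      by_cases k1 : k = n - 1
      · have : Fin.succ ⟨k, hk⟩ = Fin.last n := Fin.ext (by simp; omega)
        rw [this, Equiv.swap_comm]
        exact r0 _ (by simp) (by simp; omega)
      · exact good_mem T k hk (good k (by omega))
    · intro k hk
      apply good_mem T k hk
      by_cases k0 : k = 0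
      · rwa [k0]
      by_cases k1 : k = n - 1
      · rwa [k1]
      · exact mid k (by omega) (by omega)
end

section
/- Let n ≥ 1 and let a be a positive integer. In the group algebra ℚ[S_n], let A_a = Σ_{σ∈S_n} C(n + a − 1 − des(σ), n)·σ, for each subset S of {1,…,n−1} let X_S = Σ_{σ : Des(σ) ⊆ S} σ, and define Z_n = Σ_{S ⊆ {1,…,n−1}} ((−1)^{|S|}/(|S|+1))·X_S. Then A_a · Z_n = a·Z_n; that is, Z_n is an eigenvector with eigenvalue a for left multiplication by the (unnormalized) a-shuffle element A_a. -/
/-- The basis element `X_S = Σ_{σ : Des(σ) ⊆ S} σ` of the group algebra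
`ℚ[S_{n+1}]`. -/
noncomputable def Xel (n : ℕ) (S : Finset (Fin n)) :
    MonoidAlgebra ℚ (Equiv.Perm (Fin (n + 1))) :=
  ∑ σ ∈ Finset.univ.filter (fun σ : Equiv.Perm (Fin (n + 1)) => Des σ ⊆ S),
    MonoidAlgebra.single σ (1 : ℚ)

/-- The unnormalized `a`-shuffle element
`A_a = Σ_σ C((n+1) + a − 1 − des(σ), n+1)·σ` of `ℚ[S_{n+1}]`. -/
noncomputable def Ael (n a : ℕ) : MonoidAlgebra ℚ (Equiv.Perm (Fin (n + 1))) :=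
  ∑ σ : Equiv.Perm (Fin (n + 1)),
    MonoidAlgebra.single σ ((Nat.choose (n + a - (Des σ).card) (n + 1) : ℚ))

/-- The element `Z = Σ_S ((−1)^{|S|}/(|S|+1)) X_S` of `ℚ[S_{n+1}]`. -/
noncomputable def Zel (n : ℕ) : MonoidAlgebra ℚ (Equiv.Perm (Fin (n + 1))) :=
  ∑ S : Finset (Fin n), (((-1 : ℚ)) ^ S.card / ((S.card : ℚ) + 1)) • Xel n S

open Finset

theorem aux_sort {n : ℕ} {α : Type*} [LinearOrder α] (w : Fin (n+1) → α)
    (σ : Equiv.Perm (Fin (n+1))) :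
    σ = Tuple.sort w ↔ ∀ i : Fin n, w (σ i.castSucc) ≤ w (σ i.succ) ∧
      (i ∈ Des σ → w (σ i.castSucc) < w (σ i.succ)) := by
  rw [Tuple.eq_sort_iff]
  constructor
  · rintro ⟨h1, h2⟩ i
    have h3 := h1 (Fin.castSucc_lt_succ (i := i)).le
    refine ⟨h3, fun hi => lt_of_le_of_ne h3 fun he => ?_⟩
    have := h2 _ _ (Fin.castSucc_lt_succ (i := i)) he
    simp only [Des, mem_filter, mem_univ, true_and] at hi
    exact lt_asymm this hi
  · intro h
    have hm : StrictMono (fun i => toLex (w (σ i), σ i)) := by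
      rw [Fin.strictMono_iff_lt_succ]
      intro i
      rw [Prod.Lex.toLex_lt_toLex]
      obtain ⟨h1, h2⟩ := h i
      rcases h1.lt_or_eq with h3 | h3
      · exact Or.inl h3
      · refine Or.inr ⟨h3, ?_⟩
        have h4 : i ∉ Des σ := fun h5 => (h2 h5).ne h3
        simp only [Des, mem_filter, mem_univ, true_and, not_lt] at h4
        refine lt_of_le_of_ne h4 fun h5 => ?_
        exact (Fin.castSucc_lt_succ (i := i)).ne (σ.injective h5)
    refine ⟨Fin.monotone_iff_le_succ.2 fun i => (h i).1, fun i j hij he => ?_⟩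
    have := hm hij
    rw [Prod.Lex.toLex_lt_toLex] at this
    rcases this with h | h
    · exact absurd he h.ne
    · exact h.2

theorem aux_c {n : ℕ} (D : Finset (Fin n)) : ∃ c : Fin (n+1) → ℕ, c 0 = 0 ∧
    (∀ i : Fin n, (i ∈ D → c i.succ = c i.castSucc) ∧ (i ∉ D → c i.succ = c i.castSucc + 1)) ∧
    c (Fin.last n) + D.card = n := by
  refine ⟨fun i => (Dᶜ.filter (fun j => j.castSucc < i)).card, by simp, fun i => ⟨fun hi => ?_, fun hi => ?_⟩, ?_⟩
  · refine congrArg Finset.card ?_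
    ext j
    simp only [mem_filter, mem_compl, Fin.castSucc_lt_succ_iff, Fin.castSucc_lt_castSucc_iff]
    constructor
    · rintro ⟨h1, h2⟩
      exact ⟨h1, lt_of_le_of_ne h2 (by rintro rfl; exact h1 hi)⟩
    · rintro ⟨h1, h2⟩
      exact ⟨h1, h2.le⟩
  · rw [← card_insert_of_notMem (a := i)]
    · refine congrArg Finset.card ?_
      ext j
      simp only [mem_filter, mem_compl, Fin.castSucc_lt_succ_iff, Fin.castSucc_lt_castSucc_iff, mem_insert]
      constructor
      · rintro ⟨h1, h2⟩
        rcases h2.lt_or_eq with h | h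
        · exact Or.inr ⟨h1, h⟩
        · exact Or.inl h
      · rintro (rfl | ⟨h1, h2⟩)
        · exact ⟨hi, le_rfl⟩
        · exact ⟨h1, h2.le⟩
    · simp
  · simp only [Fin.castSucc_lt_last, filter_true]
    rw [card_compl, Fintype.card_fin]
    have := card_le_univ D
    rw [Fintype.card_fin] at this
    omega

theorem aux_count {n a : ℕ} (σ : Equiv.Perm (Fin (n+1))) :
    (univ.filter (fun w : Fin (n+1) → Fin a => Tuple.sort w = σ)).card
      = Nat.choose (n + a - (Des σ).card) (n+1) := by
  obtain ⟨c, c0, cs, cl⟩ := aux_c (Des σ)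
  have hN : Nat.card (Fin (n+1) ↪o Fin (n + a - (Des σ).card))
      = Nat.choose (n + a - (Des σ).card) (n+1) := by
    rw [Nat.card_congr Set.powersetCard.ofFinEmbEquiv, Set.powersetCard.card, Nat.card_eq_fintype_card, Fintype.card_fin]
  rw [← hN, ← Fintype.card_subtype, ← Nat.card_eq_fintype_card]
  set m := n + a - (Des σ).card with hm
  have key1 : ∀ w : Fin (n+1) → Fin a, Tuple.sort w = σ →
      StrictMono (fun i => (w (σ i) : ℕ) + c i) := by
    intro w hw
    rw [eq_comm, aux_sort] at hw
    rw [Fin.strictMono_iff_lt_succ]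
    intro i
    have h1 := hw i
    have h2 := cs i
    rw [Fin.le_def, Fin.lt_def] at h1
    by_cases hi : i ∈ Des σ
    · have := h1.2 hi; have := h2.1 hi; omega
    · have := h1.1; have := h2.2 hi; omega
  have key2 : ∀ g : Fin (n+1) → Fin m, StrictMono g → ∀ i, c i ≤ g i := by
    intro g hg i
    induction i using Fin.induction with
    | zero => omega
    | succ i ih =>
      have h1 := hg (Fin.castSucc_lt_succ (i := i))
      rw [Fin.lt_def] at h1
      have h2 := cs i
      by_cases hi : i ∈ Des σ
      · have := h2.1 hi; omega
      · have := h2.2 hi; omega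
  have key3 : ∀ g : Fin (n+1) → Fin m, StrictMono g → Monotone (fun i => (g i : ℕ) - c i) := by
    intro g hg
    rw [Fin.monotone_iff_le_succ]
    intro i
    have h1 := hg (Fin.castSucc_lt_succ (i := i))
    rw [Fin.lt_def] at h1
    have h2 := cs i
    by_cases hi : i ∈ Des σ
    · have := h2.1 hi; omega
    · have := h2.2 hi; omega
  have key4 : ∀ g : Fin (n+1) → Fin m, StrictMono g → ∀ i, (g i : ℕ) - c i < a := by
    intro g hg i
    have h1 := key3 g hg (Fin.le_last i)
    have h2 := key2 g hg (Fin.last n)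
    have h3 := (g (Fin.last n)).2
    simp only at h1
    omega
  refine Nat.card_congr
    { toFun := fun w => OrderEmbedding.ofStrictMono (fun i => ⟨(w.1 (σ i) : ℕ) + c i, ?_⟩) ?_
      invFun := fun g => ⟨fun j => ⟨(g (σ.symm j) : ℕ) - c (σ.symm j), key4 g g.strictMono _⟩, ?_⟩
      left_inv := ?_
      right_inv := ?_ }
  · have h1 := (key1 w.1 w.2).monotone (Fin.le_last i)
    have h3 := (w.1 (σ (Fin.last n))).2
    omega
  · intro i j hij
    exact key1 w.1 w.2 hij
  · rw [eq_comm, aux_sort]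
    intro i
    have h1 := g.strictMono (Fin.castSucc_lt_succ (i := i))
    have h2 := cs i
    have h3 := key2 g g.strictMono i.castSucc
    simp only [Equiv.symm_apply_apply, Fin.le_def, Fin.lt_def] at h1 ⊢
    by_cases hi : i ∈ Des σ
    · have := h2.1 hi; omega
    · have := h2.2 hi
      refine ⟨by omega, fun h => absurd h hi⟩
  · intro w
    ext j
    change (w.1 (σ (σ.symm j)) : ℕ) + c (σ.symm j) - c (σ.symm j) = (w.1 j : ℕ)
    simp
  · intro g
    ext i
    have h3 := key2 g g.strictMono i
    change (g (σ.symm (σ i)) : ℕ) - c (σ.symm (σ i)) + c i = (g i : ℕ)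
    rw [Equiv.symm_apply_apply]
    omega

theorem aux_count' {n : ℕ} {α : Type*} [LinearOrder α] [Fintype α] (σ : Equiv.Perm (Fin (n+1))) :
    (univ.filter (fun w : Fin (n+1) → α => Tuple.sort w = σ)).card
      = Nat.choose (n + Fintype.card α - (Des σ).card) (n+1) := by
  rw [← aux_count]
  let e := (Fintype.orderIsoFinOfCardEq α rfl).symm
  refine card_equiv (Equiv.arrowCongr (Equiv.refl _) e.toEquiv) ?_
  intro w
  simp only [mem_filter, mem_univ, true_and]
  rw [eq_comm, aux_sort, @eq_comm _ (Tuple.sort _), aux_sort]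
  simp

theorem aux_word {n : ℕ} {α : Type*} [LinearOrder α] [Fintype α] :
    ∑ w : Fin (n+1) → α, MonoidAlgebra.single (Tuple.sort w) (1:ℚ) = Ael n (Fintype.card α) := by
  unfold Ael
  rw [← sum_fiberwise (s := univ) (g := fun w : Fin (n+1) → α => Tuple.sort w)]
  refine sum_congr rfl fun σ _ => ?_
  rw [← aux_count', sum_congr rfl (g := fun _ => MonoidAlgebra.single σ (1:ℚ))]
  · rw [sum_const, MonoidAlgebra.smul_single]; simp
  · intro w hw
    rw [(mem_filter.1 hw).2]

theorem aux_mul (n a b : ℕ) : Ael n a * Ael n b = Ael n (b * a) := by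
  have h1 := aux_word (n := n) (α := Fin a)
  have h2 := aux_word (n := n) (α := Fin b)
  have h3 := aux_word (n := n) (α := Fin b ×ₗ Fin a)
  rw [Fintype.card_fin] at h1 h2
  rw [Fintype.card_lex, Fintype.card_prod, Fintype.card_fin, Fintype.card_fin] at h3
  rw [← h1, ← h2, ← h3, sum_mul_sum, ← sum_product']
  refine sum_bij' (fun p _ => fun i => toLex (p.2 ((Tuple.sort p.1).symm i), p.1 i))
    (fun w _ => (fun i => (ofLex (w i)).2,
      fun i => (ofLex (w (Tuple.sort (fun i => (ofLex (w i)).2) i))).1)) ?_ ?_ ?_ ?_ ?_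
  · simp
  · simp
  · rintro ⟨u, v⟩ _
    simp
  · intro w _
    simp
  · rintro ⟨u, v⟩ _
    rw [MonoidAlgebra.single_mul_single, one_mul]
    congr 1
    rw [Tuple.eq_sort_iff]
    obtain ⟨hu1, hu2⟩ := Tuple.eq_sort_iff.1 (rfl : Tuple.sort u = Tuple.sort u)
    obtain ⟨hv1, hv2⟩ := Tuple.eq_sort_iff.1 (rfl : Tuple.sort v = Tuple.sort v)
    constructor
    · intro i j hij
      rcases hij.eq_or_lt with rfl | hij
      · exact le_rfl
      simp only [Function.comp, Equiv.Perm.mul_apply, Equiv.symm_apply_apply, Prod.Lex.toLex_le_toLex]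
      rcases (hv1 hij.le).lt_or_eq with h | h
      · exact Or.inl h
      · exact Or.inr ⟨h, hu1 (hv2 i j hij h).le⟩
    · intro i j hij h
      simp only [Equiv.Perm.mul_apply, Equiv.symm_apply_apply, EmbeddingLike.apply_eq_iff_eq, Prod.mk.injEq] at h ⊢
      exact hu2 _ _ (hv2 i j hij h.1) h.2

open Polynomial in
noncomputable def auxP (m d : ℕ) : ℚ[X] :=
  C (1 / ((m + d + 1).factorial : ℚ)) * (X * ((∏ j ∈ range m, (X + C ((j : ℚ) + 1))) * ∏ j ∈ range d, (X - C ((j : ℚ) + 1))))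

theorem auxP_eval (m d b : ℕ) : (auxP m d).eval (b : ℚ) = (Nat.choose (m + b) (m + d + 1) : ℚ) := by
  have key : (b:ℚ) * ((∏ j ∈ range m, ((b:ℚ) + ((j : ℚ) + 1))) * ∏ j ∈ range d, ((b:ℚ) - ((j : ℚ) + 1)))
      = (Nat.descFactorial (m + b) (m + d + 1) : ℚ) := by
    induction d with
    | zero =>
      simp only [range_zero, prod_empty, mul_one, add_zero]
      induction m with
      | zero => simp
      | succ m ih =>
        rw [show m + 1 + b = (m + b) + 1 by ring, Nat.succ_descFactorial_succ, prod_range_succ, ← mul_assoc, ih]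
        push_cast; ring
    | succ d ih =>
      rw [prod_range_succ, ← mul_assoc, ← mul_assoc, mul_assoc (b:ℚ), ih, ← add_assoc, Nat.descFactorial_succ (m+b) (m+d+1)]
      rcases le_or_gt (m + d + 1) (m + b) with h | h
      · push_cast [Nat.cast_sub h]; ring
      · rw [Nat.descFactorial_of_lt h]; simp
  unfold auxP
  simp only [Polynomial.eval_mul, Polynomial.eval_C, Polynomial.eval_X, Polynomial.eval_prod, Polynomial.eval_add, Polynomial.eval_sub]
  rw [key, Nat.descFactorial_eq_factorial_mul_choose]
  have : ((m+d+1).factorial : ℚ) ≠ 0 := by positivity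
  push_cast
  field_simp

theorem auxP_coeff (m d : ℕ) : (auxP m d).coeff 1 = (-1)^d * (m.factorial * d.factorial / (m+d+1).factorial : ℚ) := by
  unfold auxP
  rw [Polynomial.coeff_C_mul, Polynomial.coeff_X_mul, Polynomial.coeff_zero_eq_eval_zero]
  simp only [Polynomial.eval_mul, Polynomial.eval_C, Polynomial.eval_X, Polynomial.eval_prod, Polynomial.eval_add, Polynomial.eval_sub, zero_add, zero_sub]
  have h : ∀ k : ℕ, ∏ j ∈ range k, ((j:ℚ)+1) = k.factorial := by
    intro k
    rw [← prod_range_add_one_eq_factorial]; push_cast; rfl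
  rw [prod_neg, h, h, card_range]
  ring

theorem aux_beta (m d : ℕ) : ∑ k ∈ range (m+1), (m.choose k : ℚ) * ((-1)^(d+k) / (((d + k : ℕ) : ℚ) + 1))
    = (-1)^d * (m.factorial * d.factorial / (m+d+1).factorial : ℚ) := by
  induction m generalizing d with
  | zero =>
    have : (d.factorial : ℚ) ≠ 0 := by positivity
    simp [Nat.factorial_succ]
    field_simp
  | succ m ih =>
    have h1 := ih d
    have h2 := ih (d+1)
    rw [sum_range_succ'] at h1 ⊢
    have e : ∑ k ∈ range (m + 1), ((m + 1).choose (k + 1) : ℚ) * ((-1) ^ (d + (k + 1)) / (((d + (k + 1) : ℕ) : ℚ) + 1))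
      = ∑ k ∈ range (m + 1), (m.choose k : ℚ) * ((-1)^(d + 1 + k) / (((d + 1 + k : ℕ) : ℚ) + 1))
       + ∑ k ∈ range m, (m.choose (k+1) : ℚ) * ((-1) ^ (d + (k + 1)) / (((d + (k + 1) : ℕ) : ℚ) + 1)) := by
      rw [← add_zero (∑ k ∈ range m, _), ← zero_mul ((-1:ℚ) ^ (d + (m + 1)) / (((d + (m + 1) : ℕ) : ℚ) + 1)),
        ← Nat.cast_zero, ← Nat.choose_eq_zero_of_lt (Nat.lt_succ_self m), ← sum_range_succ, ← sum_add_distrib]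
      refine sum_congr rfl fun k _ => ?_
      rw [Nat.choose_succ_succ, show d + 1 + k = d + (k+1) by ring]
      push_cast; ring
    rw [e, h2, add_assoc]
    simp only [Nat.choose_zero_right] at h1 ⊢
    rw [h1, show m + (d+1) + 1 = (m + d + 1) + 1 by ring, show m + 1 + d + 1 = (m + d + 1) + 1 by ring]
    have : ((m+d+1).factorial : ℚ) ≠ 0 := by positivity
    simp only [Nat.factorial_succ (m+d+1), Nat.factorial_succ m, Nat.factorial_succ d]
    push_cast
    field_simp
    ring

theorem aux_Zcoeff (n : ℕ) (τ : Equiv.Perm (Fin (n+1))) :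
    (Zel n).coeff τ = (auxP (n - (Des τ).card) (Des τ).card).coeff 1 := by
  have hX : ∀ S, (Xel n S).coeff τ = if Des τ ⊆ S then 1 else 0 := by
    intro S
    unfold Xel
    simp [MonoidAlgebra.coeff_sum, Finsupp.single_apply, Finsupp.finset_sum_apply]
  rw [auxP_coeff, ← aux_beta]
  unfold Zel
  simp only [MonoidAlgebra.coeff_sum, Finsupp.finset_sum_apply, MonoidAlgebra.coeff_smul_apply, hX, smul_eq_mul, mul_ite, mul_one, mul_zero]
  rw [← sum_filter]
  have h : univ.filter (fun S => Des τ ⊆ S) = (univ \ Des τ).powerset.image (Des τ ∪ ·) := by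
    rw [← Icc_eq_image_powerset (subset_univ _)]
    ext S; simp
  have hd : ∀ T ∈ (univ \ Des τ).powerset, Disjoint (Des τ) T := by
    intro T hT
    rw [mem_powerset] at hT
    exact (disjoint_sdiff (s := Des τ) (t := univ)).mono_right hT
  rw [h, sum_image]
  · rw [sum_congr rfl (g := fun T => (fun k : ℕ => (-1:ℚ)^((Des τ).card + k) / ((((Des τ).card + k : ℕ) : ℚ) + 1)) T.card)]
    · rw [sum_powerset_apply_card (fun k : ℕ => (-1:ℚ)^((Des τ).card + k) / ((((Des τ).card + k : ℕ) : ℚ) + 1)),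
        card_sdiff_of_subset (subset_univ _)]
      simp
    · intro T hT
      simp only [card_union_of_disjoint (hd T hT)]
  · intro T hT T' hT' he
    have h1 := hd T hT
    have h2 := hd T' hT'
    simp only at he
    rw [← union_sdiff_cancel_left h1, he, union_sdiff_cancel_left h2]

theorem aux_Acoeff (n b : ℕ) (τ : Equiv.Perm (Fin (n+1))) :
    (Ael n b).coeff τ = (auxP (n - (Des τ).card) (Des τ).card).eval (b:ℚ) := by
  have hd : (Des τ).card ≤ n := by simpa using card_le_univ (Des τ)
  rw [auxP_eval, show n - (Des τ).card + b = n + b - (Des τ).card by omega, Nat.sub_add_cancel hd]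
  unfold Ael
  simp [MonoidAlgebra.coeff_sum, Finsupp.single_apply, Finsupp.finset_sum_apply]

theorem aux_mulcoeff (n : ℕ) (x y : MonoidAlgebra ℚ (Equiv.Perm (Fin (n + 1)))) (τ) :
    (x * y).coeff τ = ∑ σ, x.coeff σ * y.coeff (σ⁻¹ * τ) := by
  rw [MonoidAlgebra.coeff_mul_apply_left, Finsupp.sum_fintype]
  simp

/-- `Z` is an eigenvector with eigenvalue `a` for left
multiplication by the unnormalized `a`-shuffle element `A_a`. -/
theorem ashuffle_eigenvector (n a : ℕ) (ha : 1 ≤ a) :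
    Ael n a * Zel n = (a : ℚ) • Zel n := by
  let P : Equiv.Perm (Fin (n+1)) → Polynomial ℚ := fun τ => auxP (n - (Des τ).card) (Des τ).card
  ext τ
  rw [aux_mulcoeff, MonoidAlgebra.coeff_smul_apply, aux_Zcoeff]
  simp only [aux_Zcoeff]
  have key : ∑ σ, Polynomial.C ((Ael n a).coeff σ) * P (σ⁻¹ * τ)
      = (P τ).comp (Polynomial.C (a:ℚ) * Polynomial.X) := by
    refine Polynomial.eq_of_infinite_eval_eq _ _
      ((Set.infinite_range_of_injective (Nat.cast_injective (R := ℚ))).mono ?_)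
    rintro _ ⟨b, rfl⟩
    simp only [Set.mem_setOf_eq, Polynomial.eval_finset_sum, Polynomial.eval_mul, Polynomial.eval_C,
      Polynomial.eval_comp, Polynomial.eval_X]
    have h := aux_Acoeff n (b * a) τ
    rw [← aux_mul, aux_mulcoeff] at h
    simp only [aux_Acoeff n b] at h
    rw [h]
    push_cast
    rw [mul_comm]
  have h := congrArg (fun p => Polynomial.coeff p 1) key
  simp only [Polynomial.finset_sum_coeff, Polynomial.coeff_C_mul, Polynomial.comp_C_mul_X_coeff, pow_one] at h
  rw [h, smul_eq_mul, mul_comm]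
end

section
/- Let n ≥ 1 and let r = (r_0, r_1, r_2, …) be a sequence of nonnegative real numbers with Σ_j r_j = 1. For each subset S of {1,…,n−1} choose a permutation π_S ∈ S_n with Des(π_S) = S, and define the matrix M, with rows and columns indexed by subsets of {1,…,n−1}, by M(S,T) = Σ_{τ : Des(τ) = T} F_{Des(π_S∘τ⁻¹)}(r). Then the characteristic polynomial of M equals Π (x − p_{a_1}(r)·p_{a_2}(r)⋯p_{a_k}(r)), the product over all compositions (a_1,…,a_k) of n, where p_m(r) = Σ_{j≥0} (r_j)^m is the m-th power sum evaluated at r. In particular, the characteristic polynomial is independent of the choice of representatives π_S, and the eigenvalues of M are the power sums p_μ(r) for partitions μ of n, each with multiplicity equal to the number of compositions of n obtained by rearranging the parts of μ. -/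
/-- The fundamental quasisymmetric function `F_S` evaluated at `r`. -/
noncomputable def Fqs {n : ℕ} (r : ℕ → ℝ) (S : Finset (Fin n)) : ℝ :=
  ∑' p : {i : Fin (n + 1) → ℕ //
      (∀ k : Fin n, i k.castSucc ≤ i k.succ) ∧ ∀ k ∈ S, i k.castSucc < i k.succ},
    ∏ j, r (p.1 j)

theorem hasSum_pi_prod (m : ℕ) (f : Fin m → ℕ → ℝ) (h0 : ∀ i j, 0 ≤ f i j)
    (hs : ∀ i, Summable (f i)) :
    HasSum (fun h : Fin m → ℕ => ∏ i, f i (h i)) (∏ i, ∑' j, f i j) := by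
  induction m with
  | zero =>
      simp only [Finset.univ_eq_empty, Finset.prod_empty]
      exact hasSum_unique (fun _ : Fin 0 → ℕ => (1:ℝ))
  | succ m ihm =>
      have ih := ihm (fun i => f i.succ) (fun i => h0 _) (fun i => hs _)
      rw [← (Fin.consEquiv (fun _ : Fin (m+1) => ℕ)).hasSum_iff, Fin.prod_univ_succ]
      have h3 : Summable fun x : ℕ × (Fin m → ℕ) => f 0 x.1 * ∏ i : Fin m, f i.succ (x.2 i) :=
        Summable.mul_of_nonneg (g := fun h : Fin m → ℕ => ∏ i : Fin m, f i.succ (h i))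
          (hs 0) ih.summable (fun j => h0 0 j)
          (fun h => Finset.prod_nonneg fun i _ => h0 _ _)
      have h2 := HasSum.mul (g := fun h : Fin m → ℕ => ∏ i : Fin m, f i.succ (h i))
        (hs 0).hasSum ih h3
      have e : (fun h : Fin (m+1) → ℕ => ∏ i, f i (h i)) ∘
          (Fin.consEquiv (fun _ : Fin (m+1) => ℕ)) =
          fun x : ℕ × (Fin m → ℕ) => f 0 x.1 * ∏ i : Fin m, f i.succ (x.2 i) := by
        funext x
        simp [Fin.prod_univ_succ, Fin.consEquiv]
      rw [e]
      exact h2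

theorem charpoly_tri_aux {α : Type*} [Fintype α] [d : DecidableEq α] (lo : LinearOrder α)
    (N : Matrix α α ℝ) (h : ∀ i j, N i j ≠ 0 → i ≤ j) :
    N.charpoly = ∏ i, (Polynomial.X - Polynomial.C (N i i)) ∧ N.det = ∏ i, N i i := by
  have hd : d = lo.toDecidableEq := Subsingleton.elim _ _
  subst hd
  have hN : N.IsUpperTriangular := by
    intro i j hij
    by_contra hne
    exact absurd (h i j hne) (not_le.2 hij)
  exact ⟨Matrix.charpoly_of_isUpperTriangular N hN, Matrix.det_of_isUpperTriangular hN⟩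

theorem charpoly_tri {α : Type*} [Fintype α] [DecidableEq α] [PartialOrder α]
    (N : Matrix α α ℝ) (h : ∀ i j, N i j ≠ 0 → i ≤ j) :
    N.charpoly = ∏ i, (Polynomial.X - Polynomial.C (N i i)) ∧ N.det = ∏ i, N i i :=
  @charpoly_tri_aux α _ _ (inferInstance : LinearOrder (LinearExtension α)) N
    (fun i j hij => (toLinearExtension (α := α)).monotone (h i j hij))

theorem charpoly_conj_tri {α : Type*} [Fintype α] [DecidableEq α] [PartialOrder α]
    (M N Z : Matrix α α ℝ) (hZ : ∀ i j, Z i j ≠ 0 → i ≤ j) (hZ1 : ∀ i, Z i i = 1)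
    (hN : ∀ i j, N i j ≠ 0 → j ≤ i) (h : M * Z = Z * N) :
    M.charpoly = ∏ i, (Polynomial.X - Polynomial.C (N i i)) := by
  have hd : IsUnit Z.det := by rw [(charpoly_tri Z hZ).2]; simp [hZ1]
  have hN' : N.charpoly = ∏ i, (Polynomial.X - Polynomial.C (N i i)) := by
    rw [← Matrix.charpoly_transpose, (charpoly_tri N.transpose (fun i j hij => hN j i hij)).1]
    rfl
  have : M = Z * (N * Z⁻¹) := by
    rw [← mul_assoc, ← h, mul_assoc, Matrix.mul_nonsing_inv _ hd, mul_one]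
  rw [← hN', this, Matrix.charpoly_mul_comm, mul_assoc, Matrix.nonsing_inv_mul _ hd, mul_one]

theorem mem_Des {n : ℕ} (σ : Equiv.Perm (Fin (n+1))) (k : Fin n) :
    k ∈ Des σ ↔ σ k.succ < σ k.castSucc := by
  simp [Des]

theorem valid_iff {n : ℕ} (σ ρ : Equiv.Perm (Fin (n+1))) (g : Fin (n+1) → ℕ) :
    ((∀ k : Fin n, (g ∘ ρ) k.castSucc ≤ (g ∘ ρ) k.succ) ∧
      ∀ k ∈ Des (σ * ρ), (g ∘ ρ) k.castSucc < (g ∘ ρ) k.succ) ↔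
    ρ = Tuple.sort (fun i => toLex (g i, σ i)) := by
  set key : Fin (n+1) → ℕ ×ₗ Fin (n+1) := fun i => toLex (g i, σ i) with hkey
  have kinj : Function.Injective key := by
    intro a b hab
    have := congrArg (fun x => (ofLex x).2) hab
    exact σ.injective this
  have h1 : (ρ = Tuple.sort key) ↔ StrictMono (key ∘ ρ) := by
    constructor
    · rintro rfl
      exact (Tuple.monotone_sort key).strictMono_of_injective
        (kinj.comp (Tuple.sort key).injective)
    · intro h
      have := Tuple.unique_monotone h.monotone (Tuple.monotone_sort key)
      ext1 i
      exact kinj (congrFun this i)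
  rw [h1, Fin.strictMono_iff_lt_succ, ← forall_and]
  refine forall_congr' fun k => ?_
  have hne : σ (ρ k.castSucc) ≠ σ (ρ k.succ) := by
    intro h
    have := ρ.injective (σ.injective h)
    exact absurd this (Fin.castSucc_lt_succ).ne
  simp only [mem_Des, Equiv.Perm.mul_apply,
    Function.comp, hkey, Prod.Lex.toLex_lt_toLex]
  generalize σ (ρ k.castSucc) = a at *
  generalize σ (ρ k.succ) = b at *
  have := lt_or_gt_of_ne hne
  constructor
  · rintro ⟨h, h'⟩
    rcases this with h3 | h3
    · rcases h.lt_or_eq with h4 | h4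
      · exact Or.inl h4
      · exact Or.inr ⟨h4, h3⟩
    · exact Or.inl (h' h3)
  · rintro (h | ⟨h, h'⟩)
    · exact ⟨h.le, fun _ => h⟩
    · exact ⟨h.le, fun h3 => absurd h3 h'.not_gt⟩

/-- the condition on words -/
def wcond {n : ℕ} (S J : Finset (Fin n)) (g : Fin (n+1) → ℕ) : Prop :=
  ∀ i : Fin n, i ∉ J → g i.castSucc < g i.succ ∨ (g i.castSucc = g i.succ ∧ i ∉ S)

theorem des_sort_iff {n : ℕ} (σ : Equiv.Perm (Fin (n+1))) (g : Fin (n+1) → ℕ)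
    (J : Finset (Fin n)) :
    Des ((Tuple.sort (fun i => toLex (g i, σ i)) : Equiv.Perm (Fin (n+1)))⁻¹) ⊆ J ↔
      wcond (Des σ) J g := by
  set key : Fin (n+1) → ℕ ×ₗ Fin (n+1) := fun i => toLex (g i, σ i) with hkey
  set ρ := Tuple.sort key
  have kinj : Function.Injective key := by
    intro a b hab
    have := congrArg (fun x => (ofLex x).2) hab
    exact σ.injective this
  have hs : StrictMono (key ∘ ρ) := (Tuple.monotone_sort key).strictMono_of_injective
        (kinj.comp (Tuple.sort key).injective)
  have hlt : ∀ a b, ρ⁻¹ a < ρ⁻¹ b ↔ key a < key b := by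
    intro a b
    rw [← hs.lt_iff_lt]
    simp
  unfold wcond
  refine forall_congr' fun k => ?_
  have hne : σ k.castSucc ≠ σ k.succ := by
    intro h
    exact absurd (σ.injective h) (Fin.castSucc_lt_succ).ne
  rw [← not_imp_not]
  refine imp_congr_right fun _ => ?_
  simp only [mem_Des, hlt, not_lt, hkey,
    Prod.Lex.toLex_le_toLex]

open Classical in
theorem sum_Fqs {n : ℕ} (r : ℕ → ℝ) (hs : Summable fun g : Fin (n+1) → ℕ => ∏ i, r (g i))
    (σ : Equiv.Perm (Fin (n+1))) (J : Finset (Fin n)) :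
    ∑ τ ∈ Finset.univ.filter (fun τ : Equiv.Perm (Fin (n + 1)) => Des τ ⊆ J),
        Fqs r (Des (σ * τ⁻¹)) =
    ∑' g : Fin (n+1) → ℕ, if wcond (Des σ) J g then ∏ i, r (g i) else 0 := by
  have hsum : ∀ (P : (Fin (n+1) → ℕ) → Prop) [DecidablePred P],
      Summable fun g => if P g then ∏ i, r (g i) else 0 := fun P _ => by
    have e : (fun g => if P g then ∏ i, r (g i) else 0) =
        Set.indicator {g | P g} (fun g : Fin (n+1) → ℕ => ∏ i, r (g i)) := by
      funext g
      by_cases h : P g <;> simp [h]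
    rw [e]
    exact hs.indicator _
  have h1 : ∀ τ : Equiv.Perm (Fin (n+1)), Fqs r (Des (σ * τ⁻¹)) =
      ∑' g : Fin (n+1) → ℕ, if τ⁻¹ = Tuple.sort (fun i => toLex (g i, σ i))
        then ∏ i, r (g i) else 0 := by
    intro τ
    unfold Fqs
    refine (tsum_subtype {i : Fin (n + 1) → ℕ | (∀ k : Fin n, i k.castSucc ≤ i k.succ) ∧
      ∀ k ∈ Des (σ * τ⁻¹), i k.castSucc < i k.succ} (fun i => ∏ j, r (i j))).trans ?_
    rw [← (Equiv.arrowCongr τ (Equiv.refl ℕ)).tsum_eq]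
    refine tsum_congr fun g => ?_
    have h2 : (Equiv.arrowCongr τ (Equiv.refl ℕ)) g = g ∘ (τ⁻¹ : Equiv.Perm _) := rfl
    rw [h2]
    by_cases h : τ⁻¹ = Tuple.sort (fun i => toLex (g i, σ i))
    · rw [if_pos h]
      refine (Set.indicator_of_mem ?_ _).trans (Equiv.prod_comp τ⁻¹ (fun i => r (g i)))
      exact (valid_iff σ τ⁻¹ g).2 h
    · rw [if_neg h]
      refine Set.indicator_of_notMem ?_ _
      exact fun hh => h ((valid_iff σ τ⁻¹ g).1 hh)
  simp only [h1]
  rw [← Summable.tsum_finsetSum (fun τ _ => hsum _)]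
  refine tsum_congr fun g => ?_
  rw [← des_sort_iff]
  set ρ := Tuple.sort (fun i => toLex (g i, σ i))
  have : ∀ τ : Equiv.Perm (Fin (n+1)), τ⁻¹ = ρ ↔ ρ⁻¹ = τ := fun τ => by
    rw [inv_eq_iff_eq_inv, eq_comm]
  simp only [this]
  rw [Finset.sum_ite_eq]
  simp

/-- the set of positions generated by a word -/
def kset {n : ℕ} (J : Finset (Fin n)) (g : Fin (n+1) → ℕ) : Finset (Fin n) :=
  J ∪ Finset.univ.filter (fun i : Fin n => g i.castSucc ≠ g i.succ)

theorem mem_kset {n : ℕ} (J : Finset (Fin n)) (g : Fin (n+1) → ℕ) (i : Fin n) :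
    i ∈ kset J g ↔ i ∈ J ∨ g i.castSucc ≠ g i.succ := by
  simp [kset]

theorem wcond_iff {n : ℕ} (S J : Finset (Fin n)) (g : Fin (n+1) → ℕ) :
    wcond S J g ↔ wcond ∅ J g ∧ S ⊆ kset J g := by
  unfold wcond
  rw [Finset.subset_iff, ← forall_and]
  refine forall_congr' fun i => ?_
  rw [mem_kset]
  have := lt_trichotomy (g i.castSucc) (g i.succ)
  simp only [Finset.notMem_empty, not_false_eq_true, and_true]
  grind

open Classical in
/-- the triangular matrix -/
noncomputable def nmat {n : ℕ} (r : ℕ → ℝ) : Matrix (Finset (Fin n)) (Finset (Fin n)) ℝ :=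
  fun K J => ∑' g : Fin (n+1) → ℕ, if wcond ∅ J g ∧ kset J g = K then ∏ i, r (g i) else 0

theorem kset_self {n : ℕ} (J : Finset (Fin n)) (g : Fin (n+1) → ℕ) :
    (wcond ∅ J g ∧ kset J g = J) ↔ ∀ i, i ∉ J → g i.castSucc = g i.succ := by
  constructor
  · rintro ⟨_, h⟩ i hi
    by_contra hne
    exact hi (h ▸ (mem_kset J g i).2 (Or.inr hne))
  · intro h
    refine ⟨fun i hi => Or.inr ⟨h i hi, by simp⟩, ?_⟩
    ext i
    rw [mem_kset]
    have := h i
    tauto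

/-- the finset attached to a composition -/
def compEquiv (n : ℕ) : Composition (n+1) ≃ Finset (Fin n) :=
  (compositionEquiv (n+1)).trans (compositionAsSetEquiv (n+1))

theorem mem_compEquiv {n : ℕ} (c : Composition (n+1)) (i : Fin n) :
    i ∈ compEquiv n c ↔ ∃ k, k ≤ c.length ∧ c.sizeUpTo k = i + 1 := by
  have h1 : i ∈ compEquiv n c ↔
      (⟨1 + (i : ℕ), by omega⟩ : Fin (n+1).succ) ∈ c.boundaries := by
    simp [compEquiv, compositionAsSetEquiv, compositionEquiv, Composition.toCompositionAsSet]
  rw [h1, Composition.boundaries]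
  simp only [Finset.mem_map, Finset.mem_univ, true_and, Composition.boundary, Fin.ext_iff]
  constructor
  · rintro ⟨k, hk⟩
    refine ⟨k, by omega, ?_⟩
    exact Eq.trans hk (add_comm _ _)
  · rintro ⟨k, hk, h⟩
    refine ⟨⟨k, by omega⟩, ?_⟩
    exact Eq.trans h (add_comm _ _)

theorem index_mono {n : ℕ} (c : Composition n) : Monotone c.index := by
  intro a b hab
  by_contra h
  rw [not_le] at h
  have h1 := c.lt_sizeUpTo_index_succ b
  have h2 := c.sizeUpTo_index_le a
  have h3 : c.sizeUpTo (c.index b).succ ≤ c.sizeUpTo (c.index a) :=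
    c.monotone_sizeUpTo (by simpa using h)
  have h4 : (a : ℕ) ≤ b := hab
  omega

theorem notMem_compEquiv {n : ℕ} (c : Composition (n+1)) (i : Fin n) :
    i ∉ compEquiv n c ↔ c.index i.castSucc = c.index i.succ := by
  rw [mem_compEquiv, ← not_iff_not, not_not]
  have h1 := c.lt_sizeUpTo_index_succ i.castSucc
  have h2 := c.sizeUpTo_index_le i.castSucc
  have h3 := c.lt_sizeUpTo_index_succ i.succ
  have h4 := c.sizeUpTo_index_le i.succ
  simp only [Fin.val_castSucc, Fin.val_succ] at h1 h2 h3 h4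
  constructor
  · rintro ⟨k, _, hk⟩ he
    rw [he] at h1 h2
    rcases le_or_gt k (c.index i.succ) with h | h
    · have := c.monotone_sizeUpTo h
      omega
    · have := c.monotone_sizeUpTo (show (c.index i.succ : ℕ) + 1 ≤ k from h)
      omega
  · intro hne
    have hlt : c.index i.castSucc < c.index i.succ :=
      lt_of_le_of_ne (index_mono c (Fin.castSucc_lt_succ).le) hne
    refine ⟨c.index i.succ, (c.index i.succ).2.le, ?_⟩
    have := c.monotone_sizeUpTo
      (show (c.index i.castSucc : ℕ) + 1 ≤ (c.index i.succ : ℕ) from hlt)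
    omega

theorem const_of_index {n : ℕ} (c : Composition (n+1)) (g : Fin (n+1) → ℕ)
    (h : ∀ i, i ∉ compEquiv n c → g i.castSucc = g i.succ) (a b : Fin (n+1)) (hab : a ≤ b)
    (hi : c.index a = c.index b) : g a = g b := by
  induction b using Fin.induction with
  | zero =>
    have : a = 0 := Fin.le_zero_iff.1 hab
    rw [this]
  | succ k ih =>
    rcases hab.eq_or_lt with h1 | h1
    · rw [h1]
    · have h2 : a ≤ k.castSucc := Fin.le_castSucc_iff.2 h1
      have h3 : c.index k.castSucc = c.index k.succ :=
        le_antisymm (index_mono c (Fin.castSucc_lt_succ).le) (hi ▸ index_mono c h2)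
      rw [ih h2 (hi.trans h3.symm), h k ((notMem_compEquiv c k).2 h3)]

theorem nmat_diag {n : ℕ} (r : ℕ → ℝ) (hr0 : ∀ j, 0 ≤ r j)
    (hs : ∀ m, 1 ≤ m → Summable fun j => r j ^ m) (c : Composition (n+1)) :
    nmat r (compEquiv n c) (compEquiv n c) =
      (c.blocks.map (fun m => ∑' j, (r j) ^ m)).prod := by
  classical
  have hsurj : Function.Surjective c.index := fun i =>
    ⟨c.embedding i ⟨0, c.one_le_blocksFun i⟩, c.index_embedding i _⟩
  have hinj : Function.Injective (fun h : Fin c.length → ℕ => h ∘ c.index) :=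
    hsurj.injective_comp_right
  unfold nmat
  simp only [kset_self]
  rw [← hinj.tsum_eq]
  · have hp := hasSum_pi_prod c.length (fun i j => r j ^ c.blocksFun i)
      (fun i j => pow_nonneg (hr0 j) _) (fun i => hs _ (c.one_le_blocksFun i))
    rw [← c.ofFn_blocksFun, List.map_ofFn, List.prod_ofFn]
    refine Eq.trans (tsum_congr fun h => ?_) hp.tsum_eq
    rw [if_pos]
    · rw [← c.blocksFinEquiv.prod_comp, Fintype.prod_sigma]
      refine Finset.prod_congr rfl fun i _ => ?_
      simp [Composition.blocksFinEquiv, Composition.index_embedding]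
    · intro i hi
      simp only [Function.comp, (notMem_compEquiv c i).1 hi]
  · intro g hg
    have hg' : ∀ i, i ∉ compEquiv n c → g i.castSucc = g i.succ := by
      by_contra hh
      exact hg (if_neg hh)
    refine ⟨fun i => g (Function.surjInv hsurj i), ?_⟩
    funext j
    have hj := Function.surjInv_eq hsurj (c.index j)
    rcases le_total (Function.surjInv hsurj (c.index j)) j with h | h
    · exact const_of_index c g hg' _ _ h hj
    · exact (const_of_index c g hg' _ _ h hj.symm).symm

theorem qs_lumped_charpoly (n : ℕ) (r : ℕ → ℝ)
    (hr0 : ∀ j, 0 ≤ r j) (hr1 : HasSum r 1)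
    (π : Finset (Fin n) → Equiv.Perm (Fin (n + 1))) (hπ : ∀ S, Des (π S) = S)
    (M : Matrix (Finset (Fin n)) (Finset (Fin n)) ℝ)
    (hM : ∀ S T, M S T =
      ∑ τ ∈ Finset.univ.filter (fun τ : Equiv.Perm (Fin (n + 1)) => Des τ = T),
        Fqs r (Des (π S * τ⁻¹))) :
    M.charpoly = ∏ c : Composition (n + 1),
      (Polynomial.X - Polynomial.C ((c.blocks.map (fun m => ∑' j, (r j) ^ m)).prod)) := by
  classical
  have hle : ∀ j, r j ≤ 1 := fun j => le_hasSum hr1 j fun i _ => hr0 i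
  have hpow : ∀ m, 1 ≤ m → Summable fun j => r j ^ m := fun m hm =>
    Summable.of_nonneg_of_le (fun j => pow_nonneg (hr0 j) _)
      (fun j => pow_le_of_le_one (hr0 j) (hle j) (by omega)) hr1.summable
  have hs : Summable fun g : Fin (n+1) → ℕ => ∏ i, r (g i) :=
    (hasSum_pi_prod (n+1) (fun _ => r) (fun _ => hr0) (fun _ => hr1.summable)).summable
  have hsum : ∀ (P : (Fin (n+1) → ℕ) → Prop) [DecidablePred P],
      Summable fun g => if P g then ∏ i, r (g i) else 0 := fun P _ => by
    have e : (fun g => if P g then ∏ i, r (g i) else 0) =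
        Set.indicator {g | P g} (fun g : Fin (n+1) → ℕ => ∏ i, r (g i)) := by
      funext g
      by_cases h : P g <;> simp [h]
    rw [e]
    exact hs.indicator _
  let Z : Matrix (Finset (Fin n)) (Finset (Fin n)) ℝ := fun S J => if S ⊆ J then 1 else 0
  have key : M * Z = Z * nmat r := by
    ext S J
    have hL : (M * Z) S J = ∑' g : Fin (n+1) → ℕ,
        if wcond S J g then ∏ i, r (g i) else 0 := by
      have h1 := sum_Fqs r hs (π S) J
      rw [hπ] at h1
      rw [← h1, Matrix.mul_apply,
        ← Finset.sum_fiberwise_of_maps_to (t := Finset.univ) (g := fun τ => Des τ)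
          (fun _ _ => Finset.mem_univ _)]
      refine Finset.sum_congr rfl fun T _ => ?_
      rw [hM, Finset.filter_filter]
      by_cases hT : T ⊆ J
      · simp only [Z, if_pos hT, mul_one]
        refine Finset.sum_congr ?_ fun _ _ => rfl
        ext τ
        simp only [Finset.mem_filter, Finset.mem_univ, true_and]
        exact ⟨fun h => ⟨h ▸ hT, h⟩, fun h => h.2⟩
      · simp only [Z, if_neg hT, mul_zero]
        symm
        refine Finset.sum_eq_zero fun τ hτ => ?_
        simp only [Finset.mem_filter, Finset.mem_univ, true_and] at hτ
        exact absurd (hτ.2 ▸ hτ.1) hT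
    have hR : (Z * (nmat r : Matrix (Finset (Fin n)) (Finset (Fin n)) ℝ)) S J = ∑' g : Fin (n+1) → ℕ,
        if wcond S J g then ∏ i, r (g i) else 0 := by
      rw [Matrix.mul_apply]
      have h2 : ∀ K, Z S K * nmat r K J = ∑' g : Fin (n+1) → ℕ,
          if S ⊆ K ∧ wcond ∅ J g ∧ kset J g = K then ∏ i, r (g i) else 0 := by
        intro K
        by_cases hK : S ⊆ K
        · simp [Z, nmat, hK]
        · simp [Z, hK]
      simp only [h2]
      rw [← Summable.tsum_finsetSum (fun K _ => hsum _)]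
      refine tsum_congr fun g => ?_
      rw [Finset.sum_eq_single (kset J g)]
      · simp only [wcond_iff S J g, and_true]
        simp only [and_comm]
      · intro K _ hK
        rw [if_neg]
        exact fun h => hK h.2.2.symm
      · simp
    rw [hL, hR]
  rw [charpoly_conj_tri M (nmat r) Z ?_ ?_ ?_ key, ← (compEquiv n).prod_comp]
  · refine Finset.prod_congr rfl fun c _ => ?_
    rw [nmat_diag r hr0 hpow]
  · intro S K h
    by_contra hn
    exact h (if_neg hn)
  · intro S
    simp [Z]
  · intro K J h
    by_contra hn
    apply h
    unfold nmat
    refine Eq.trans (tsum_congr fun g => ?_) (tsum_zero (α := ℝ) (β := Fin (n+1) → ℕ))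
    rw [if_neg]
    rintro ⟨_, rfl⟩
    exact hn (fun i hi => (mem_kset J g i).2 (Or.inl hi))
end
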